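/- Let A be a ν-dimensional face of E_q^n (q ≥ 2, 0 ≤ ν ≤ n) and let k, i be integers with 0 ≤ k ≤ n and 1 ≤ i ≤ ν. Then the number of k-dimensional faces of E_q^n containing exactly q^i elements of A equals q^{ν−i}·C(ν, i)·C(n−ν, k−i), with the convention C(m, j) = 0 for j < 0. Moreover, if e ≥ 1 is not a power q^i with 0 ≤ i ≤ ν, then no k-dimensional face contains exactly e elements of A. -/

import Mathlib

/-- The rank of a subset `A` of the cube `E_q^n`: the number of coordinates at which
`A` is not constant (the dimension of the smallest face containing `A`). -/
def cubeRank {n q : ℕ} (A : Finset (Fin n → Fin q)) : ℕ :=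
  (Finset.univ.filter fun i : Fin n => ∃ x ∈ A, ∃ y ∈ A, x i ≠ y i).card

/-- `F` is a `k`-dimensional face of `E_q^n`: all vectors agreeing with some fixed
values `c` outside a set `S` of `k` free coordinates. -/
def IsFace {n q : ℕ} (k : ℕ) (F : Finset (Fin n → Fin q)) : Prop :=
  ∃ S : Finset (Fin n), S.card = k ∧ ∃ c : Fin n → Fin q,
    F = Finset.univ.filter fun x => ∀ i ∉ S, x i = c i

/-- Binomial coefficient `C(m, j)` with an integer lower argument, equal to `0` for `j < 0`. -/
def chooseZ (m : ℕ) (j : ℤ) : ℕ := if j < 0 then 0 else m.choose j.toNat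

/-- The face of `E_q^n` with free coordinates `S` passing through `c`. -/
def cubeFace {n q : ℕ} (S : Finset (Fin n)) (c : Fin n → Fin q) : Finset (Fin n → Fin q) :=
  Finset.univ.filter fun x => ∀ i ∉ S, x i = c i

theorem mem_cubeFace {n q : ℕ} {S : Finset (Fin n)} {c x : Fin n → Fin q} :
    x ∈ cubeFace S c ↔ ∀ i ∉ S, x i = c i := by
  simp [cubeFace]

theorem self_mem_cubeFace {n q : ℕ} (S : Finset (Fin n)) (c : Fin n → Fin q) :
    c ∈ cubeFace S c :=
  mem_cubeFace.2 fun _ _ => rfl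

theorem card_cubeFace {n q : ℕ} (S : Finset (Fin n)) (c : Fin n → Fin q) :
    (cubeFace S c).card = q ^ S.card := by
  have h : cubeFace S c =
      Fintype.piFinset fun i => if i ∈ S then (Finset.univ : Finset (Fin q)) else {c i} := by
    ext x
    simp only [mem_cubeFace, Fintype.mem_piFinset]
    refine forall_congr' fun i => ?_
    by_cases hi : i ∈ S <;> simp [hi]
  rw [h, Fintype.card_piFinset]
  simp only [apply_ite Finset.card, Finset.card_univ, Fintype.card_fin, Finset.card_singleton]
  rw [Finset.prod_ite_mem, Finset.univ_inter, Finset.prod_const]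

theorem cubeFace_inter_cubeFace {n q : ℕ} {S T : Finset (Fin n)} {a b x : Fin n → Fin q}
    (ha : x ∈ cubeFace S a) (hb : x ∈ cubeFace T b) :
    cubeFace S a ∩ cubeFace T b = cubeFace (S ∩ T) x := by
  rw [mem_cubeFace] at ha hb
  ext y
  simp only [Finset.mem_inter, mem_cubeFace]
  constructor
  · rintro ⟨h₁, h₂⟩ i hi
    by_cases hS : i ∈ S
    · have hT : i ∉ T := fun hT => hi ⟨hS, hT⟩
      rw [h₂ i hT, hb i hT]
    · rw [h₁ i hS, ha i hS]
  · intro h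
    exact ⟨fun i hi => by rw [h i fun hm => hi hm.1, ha i hi],
      fun i hi => by rw [h i fun hm => hi hm.2, hb i hi]⟩

theorem subset_of_cubeFace_subset {n q : ℕ} (hq : 2 ≤ q) {S T : Finset (Fin n)}
    {a b : Fin n → Fin q} (h : cubeFace S a ⊆ cubeFace T b) : S ⊆ T := by
  intro j hj
  by_contra hT
  have : Nontrivial (Fin q) := Fin.nontrivial_iff_two_le.2 hq
  obtain ⟨v, hv⟩ := exists_ne (a j)
  have h₁ := mem_cubeFace.1 (h (self_mem_cubeFace S a)) j hT
  have hu : Function.update a j v ∈ cubeFace S a :=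
    mem_cubeFace.2 fun i hi => Function.update_of_ne (ne_of_mem_of_not_mem hj hi).symm _ _
  have h₂ := mem_cubeFace.1 (h hu) j hT
  rw [Function.update_self] at h₂
  exact hv (h₂.trans h₁.symm)

theorem cubeFace_eq_iff {n q : ℕ} (hq : 2 ≤ q) {S T : Finset (Fin n)} {a b : Fin n → Fin q} :
    cubeFace S a = cubeFace T b ↔ S = T ∧ ∀ i ∉ S, a i = b i := by
  constructor
  · intro h
    have hST : S = T := (subset_of_cubeFace_subset hq h.subset).antisymm
      (subset_of_cubeFace_subset hq h.symm.subset)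
    refine ⟨hST, fun i hi => ?_⟩
    exact mem_cubeFace.1 (h ▸ self_mem_cubeFace S a) i (hST ▸ hi)
  · rintro ⟨rfl, h⟩
    ext x
    simp only [mem_cubeFace]
    exact forall₂_congr fun i hi => by rw [h i hi]

theorem card_cubeFace_inter_eq_pow {n q : ℕ} (hq : 2 ≤ q) {S T : Finset (Fin n)}
    {a b x : Fin n → Fin q} (ha : x ∈ cubeFace S a) (hb : x ∈ cubeFace T b) (i : ℕ) :
    (cubeFace S a ∩ cubeFace T b).card = q ^ i ↔ (S ∩ T).card = i := by
  rw [cubeFace_inter_cubeFace ha hb, card_cubeFace]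
  exact Nat.pow_right_inj hq

/-- The faces with `i + l` free coordinates that meet `cubeFace S a` in `q ^ i` points, each
given by its free coordinates inside and outside `S` and a point of it that agrees with `a` off
the fixed coordinates in `S`. -/
def faceParams {n q : ℕ} (S : Finset (Fin n)) (a : Fin n → Fin q) (i l : ℕ) :
    Finset (Σ _ : Finset (Fin n) × Finset (Fin n), Fin n → Fin q) :=
  (S.powersetCard i ×ˢ Sᶜ.powersetCard l).sigma fun p => cubeFace (S \ p.1) a

theorem card_faceParams {n q : ℕ} (S : Finset (Fin n)) (a : Fin n → Fin q) (i l : ℕ) :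
    (faceParams S a i l).card =
      q ^ (S.card - i) * S.card.choose i * (n - S.card).choose l := by
  have h : ∀ p ∈ S.powersetCard i ×ˢ Sᶜ.powersetCard l,
      (cubeFace (S \ p.1) a).card = q ^ (S.card - i) := by
    intro p hp
    obtain ⟨hU, hi⟩ := Finset.mem_powersetCard.1 (Finset.mem_product.1 hp).1
    rw [card_cubeFace, Finset.card_sdiff_of_subset hU, hi]
  rw [faceParams, Finset.card_sigma, Finset.sum_congr rfl h, Finset.sum_const,
    Finset.card_product, Finset.card_powersetCard, Finset.card_powersetCard, Finset.card_compl,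
    Fintype.card_fin, smul_eq_mul]
  ring

theorem mem_faceParams {n q : ℕ} {S U W : Finset (Fin n)} {a c : Fin n → Fin q} {i l : ℕ} :
    ⟨(U, W), c⟩ ∈ faceParams S a i l ↔
      ((U ⊆ S ∧ U.card = i) ∧ Disjoint W S ∧ W.card = l) ∧ c ∈ cubeFace (S \ U) a := by
  simp [faceParams, Finset.mem_powersetCard, Finset.subset_compl_iff_disjoint_right]

theorem inter_union_of_subset_of_disjoint {α : Type*} [DecidableEq α] {S U W : Finset α}
    (hU : U ⊆ S) (hW : Disjoint W S) : S ∩ (U ∪ W) = U := by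
  rw [Finset.inter_union_distrib_left, Finset.inter_eq_right.2 hU, Finset.disjoint_iff_inter_eq_empty.1 hW.symm,
    Finset.union_empty]

theorem union_sdiff_of_subset_of_disjoint {α : Type*} [DecidableEq α] {S U W : Finset α}
    (hU : U ⊆ S) (hW : Disjoint W S) : (U ∪ W) \ S = W := by
  rw [Finset.union_sdiff_distrib, Finset.sdiff_eq_empty_iff_subset.2 hU, Finset.empty_union,
    Finset.sdiff_eq_self_of_disjoint hW]

theorem injOn_cubeFace_faceParams {n q : ℕ} (hq : 2 ≤ q) (S : Finset (Fin n))
    (a : Fin n → Fin q) (i l : ℕ) :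
    Set.InjOn (fun p : Σ _ : Finset (Fin n) × Finset (Fin n), Fin n → Fin q =>
      cubeFace (p.1.1 ∪ p.1.2) p.2) (faceParams S a i l) := by
  rintro ⟨⟨U, W⟩, c⟩ hp ⟨⟨U', W'⟩, c'⟩ hp' h
  obtain ⟨⟨⟨hU, -⟩, hW, -⟩, hc⟩ := mem_faceParams.1 hp
  obtain ⟨⟨⟨hU', -⟩, hW', -⟩, hc'⟩ := mem_faceParams.1 hp'
  obtain ⟨hT, hcc⟩ := (cubeFace_eq_iff hq).1 h
  dsimp only at hT hcc
  obtain rfl : U = U' := by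
    rw [← inter_union_of_subset_of_disjoint hU hW, hT,
      inter_union_of_subset_of_disjoint hU' hW']
  obtain rfl : W = W' := by
    rw [← union_sdiff_of_subset_of_disjoint hU hW, hT,
      union_sdiff_of_subset_of_disjoint hU' hW']
  obtain rfl : c = c' := by
    funext j
    by_cases hj : j ∈ S \ U
    · obtain ⟨hjS, hjU⟩ := Finset.mem_sdiff.1 hj
      refine hcc j fun hm => ?_
      rcases Finset.mem_union.1 hm with hm | hm
      · exact hjU hm
      · exact Finset.disjoint_left.1 hW hm hjS
    · rw [mem_cubeFace.1 hc j hj, mem_cubeFace.1 hc' j hj]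
  rfl

theorem setOf_isFace_inter_eq_image {n q : ℕ} (hq : 2 ≤ q) (S : Finset (Fin n))
    (a : Fin n → Fin q) (i l : ℕ) :
    {F : Finset (Fin n → Fin q) | IsFace (i + l) F ∧ (cubeFace S a ∩ F).card = q ^ i} =
      (fun p : Σ _ : Finset (Fin n) × Finset (Fin n), Fin n → Fin q =>
        cubeFace (p.1.1 ∪ p.1.2) p.2) '' (faceParams S a i l) := by
  ext F
  constructor
  · rintro ⟨⟨T, hT, b, rfl⟩, hF⟩
    change (cubeFace S a ∩ cubeFace T b).card = q ^ i at hF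
    obtain ⟨x, hx⟩ : (cubeFace S a ∩ cubeFace T b).Nonempty :=
      Finset.card_pos.1 (hF ▸ pow_pos (by omega) i)
    obtain ⟨ha, hb⟩ := Finset.mem_inter.1 hx
    rw [card_cubeFace_inter_eq_pow hq ha hb] at hF
    have hl : (T \ S).card = l := by
      have := Finset.card_inter_add_card_sdiff T S
      rw [Finset.inter_comm] at this
      omega
    refine ⟨⟨(S ∩ T, T \ S), fun j => if j ∈ S \ T then x j else a j⟩,
      mem_faceParams.2 ⟨⟨⟨Finset.inter_subset_left, hF⟩, Finset.sdiff_disjoint, hl⟩, ?_⟩, ?_⟩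
    · rw [Finset.sdiff_inter_self_left, mem_cubeFace]
      exact fun j hj => if_neg hj
    · have hST : S ∩ T ∪ T \ S = T := by
        rw [Finset.inter_comm, Finset.union_comm, Finset.sdiff_union_inter]
      refine (cubeFace_eq_iff hq).2 ⟨hST, fun j hj => ?_⟩
      dsimp only at hj ⊢
      rw [hST] at hj
      rw [← mem_cubeFace.1 hb j hj]
      by_cases hS : j ∈ S
      · simp [hS, hj]
      · simp [hS, mem_cubeFace.1 ha j hS]
  · rintro ⟨⟨⟨U, W⟩, c⟩, hp, rfl⟩
    obtain ⟨⟨⟨hU, hi⟩, hW, hl⟩, hc⟩ := mem_faceParams.1 hp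
    refine ⟨⟨U ∪ W, ?_, c, rfl⟩, ?_⟩
    · rw [Finset.card_union_of_disjoint (hW.mono_right hU).symm, hi, hl]
    · have hcS : c ∈ cubeFace S a := mem_cubeFace.2 fun j hj =>
        mem_cubeFace.1 hc j fun hm => hj (Finset.mem_sdiff.1 hm).1
      refine (card_cubeFace_inter_eq_pow hq hcS (self_mem_cubeFace _ c) i).2 ?_
      dsimp only
      rw [inter_union_of_subset_of_disjoint hU hW, hi]

theorem face_distribution_of_face {n q : ℕ} (hq : 2 ≤ q) (ν k : ℕ)
    (hν : ν ≤ n) (hk : k ≤ n) (A : Finset (Fin n → Fin q)) (hA : IsFace ν A) :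
    (∀ i : ℕ, 1 ≤ i → i ≤ ν →
      {F : Finset (Fin n → Fin q) | IsFace k F ∧ (A ∩ F).card = q ^ i}.ncard =
        q ^ (ν - i) * ν.choose i * chooseZ (n - ν) ((k : ℤ) - i)) ∧
    (∀ e : ℕ, 1 ≤ e → (¬ ∃ i : ℕ, i ≤ ν ∧ e = q ^ i) →
      {F : Finset (Fin n → Fin q) | IsFace k F ∧ (A ∩ F).card = e} = ∅) := by
  obtain ⟨S, rfl, a, rfl⟩ := hA
  change (∀ i : ℕ, 1 ≤ i → i ≤ S.card →
      {F | IsFace k F ∧ (cubeFace S a ∩ F).card = q ^ i}.ncard = _) ∧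
    (∀ e : ℕ, 1 ≤ e → _ → {F | IsFace k F ∧ (cubeFace S a ∩ F).card = e} = ∅)
  constructor
  · intro i _ _
    by_cases hik : i ≤ k
    · obtain ⟨l, rfl⟩ := Nat.exists_eq_add_of_le hik
      have hl : ((i + l : ℕ) : ℤ) - i = l := by push_cast; ring
      rw [setOf_isFace_inter_eq_image hq, (injOn_cubeFace_faceParams hq S a i l).ncard_image,
        Set.ncard_coe_finset, card_faceParams, hl, chooseZ, if_neg (by omega), Int.toNat_natCast]
    · rw [chooseZ, if_pos (by omega), mul_zero, Set.ncard_eq_zero,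
        Set.eq_empty_iff_forall_notMem]
      rintro _ ⟨⟨T, rfl, b, rfl⟩, hF⟩
      change (cubeFace S a ∩ cubeFace T b).card = q ^ i at hF
      have hle : q ^ i ≤ q ^ T.card := by
        rw [← hF, ← card_cubeFace T b]
        exact Finset.card_le_card Finset.inter_subset_right
      exact hik ((Nat.pow_le_pow_iff_right hq).1 hle)
  · intro e he hne
    rw [Set.eq_empty_iff_forall_notMem]
    rintro _ ⟨⟨T, -, b, rfl⟩, rfl⟩
    change 1 ≤ (cubeFace S a ∩ cubeFace T b).card at he
    obtain ⟨x, hx⟩ := Finset.card_pos.1 he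
    obtain ⟨ha, hb⟩ := Finset.mem_inter.1 hx
    refine hne ⟨(S ∩ T).card, Finset.card_le_card Finset.inter_subset_left, ?_⟩
    exact (card_cubeFace_inter_eq_pow hq ha hb _).2 rfl
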